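/- arXiv:2201.08740 — 4 statements merged into one kernel-verified Lean document; each statement's English description precedes it below -/
import Mathlib

section
/- Let n ≥ 2, let c > 0 and C ≥ 0, and let f : ℝⁿ → ℂ be a differentiable function whose derivative satisfies ‖Df(x)‖ ≤ C · exp(−c‖x‖) for every x ∈ ℝⁿ. Then there exist α ∈ ℂ and a constant C′ ≥ 0 such that ‖f(x) − α‖ ≤ C′ · exp(−c‖x‖) for all x ∈ ℝⁿ; in particular f(x) tends to α as ‖x‖ → ∞. -/
open Filter

section ExponentialDecay

variable {E F : Type*} [NormedAddCommGroup E] [NormedSpace ℝ E]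
  [NormedAddCommGroup F] [NormedSpace ℝ F] {f : E → F} {c C : ℝ}

theorem norm_sub_le_of_norm_fderiv_le_exp_on_ray (hc : 0 < c) (hf : Differentiable ℝ f)
    (hdf : ∀ x, ‖fderiv ℝ f x‖ ≤ C * Real.exp (-c * ‖x‖)) {u : E} (hu : ‖u‖ = 1)
    {s t : ℝ} (hs : 0 ≤ s) (hst : s ≤ t) :
    ‖f (t • u) - f (s • u)‖ ≤ C / c * (Real.exp (-c * s) - Real.exp (-c * t)) := by
  have hderiv (r : ℝ) :
      HasDerivAt (fun r : ℝ => f (r • u) - f (s • u)) (fderiv ℝ f (r • u) u) r := by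
    have h : HasDerivAt (fun r : ℝ => r • u) u r := by
      simpa using (hasDerivAt_id r).smul_const u
    exact ((hf (r • u)).hasFDerivAt.comp_hasDerivAt r h).sub_const _
  have hbound (r : ℝ) :
      HasDerivAt (fun r : ℝ => C / c * (Real.exp (-c * s) - Real.exp (-c * r)))
        (C * Real.exp (-c * r)) r := by
    have h : HasDerivAt (fun r : ℝ => Real.exp (-c * r)) (Real.exp (-c * r) * (-c * 1)) r :=
      ((hasDerivAt_id r).const_mul (-c)).exp
    refine ((h.const_sub (Real.exp (-c * s))).const_mul (C / c)).congr_deriv ?_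
    field_simp
  refine image_norm_le_of_norm_deriv_right_le_deriv_boundary (a := s) (b := t)
    (fun r _ => (hderiv r).continuousAt.continuousWithinAt)
    (fun r _ => (hderiv r).hasDerivWithinAt) (by simp) hbound (fun r hr => ?_)
    (Set.right_mem_Icc.2 hst)
  have hr0 : 0 ≤ r := hs.trans hr.1
  calc ‖fderiv ℝ f (r • u) u‖ ≤ ‖fderiv ℝ f (r • u)‖ * ‖u‖ := ContinuousLinearMap.le_opNorm _ _
    _ ≤ C * Real.exp (-c * r) := by
      simpa [hu, norm_smul, abs_of_nonneg hr0] using hdf (r • u)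

theorem exists_tendsto_on_ray_of_norm_fderiv_le_exp [CompleteSpace F] (hc : 0 < c) (hC : 0 ≤ C)
    (hf : Differentiable ℝ f) (hdf : ∀ x, ‖fderiv ℝ f x‖ ≤ C * Real.exp (-c * ‖x‖))
    {u : E} (hu : ‖u‖ = 1) :
    ∃ α : F, Tendsto (fun t : ℝ => f (t • u)) atTop (nhds α) ∧
      ∀ s : ℝ, 0 ≤ s → ‖f (s • u) - α‖ ≤ C / c * Real.exp (-c * s) := by
  have hCc : 0 ≤ C / c := div_nonneg hC hc.le
  have hle {s t : ℝ} (hs : 0 ≤ s) (hst : s ≤ t) :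
      ‖f (s • u) - f (t • u)‖ ≤ C / c * Real.exp (-c * s) := by
    rw [norm_sub_rev]
    refine (norm_sub_le_of_norm_fderiv_le_exp_on_ray hc hf hdf hu hs hst).trans ?_
    gcongr
    linarith [Real.exp_pos (-c * t)]
  have hexp : Tendsto (fun t : ℝ => C / c * Real.exp (-c * t)) atTop (nhds 0) := by
    simpa using (Real.tendsto_exp_atBot.comp
      (tendsto_id.const_mul_atTop_of_neg (neg_lt_zero.2 hc))).const_mul (C / c)
  have hcauchy : CauchySeq (fun t : ℝ => f (t • u)) := by
    refine Metric.cauchySeq_iff'.2 fun ε hε => ?_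
    obtain ⟨N, hN, hN0⟩ :=
      ((hexp.eventually (gt_mem_nhds hε)).and (eventually_ge_atTop 0)).exists
    refine ⟨N, fun t ht => ?_⟩
    rw [dist_comm, dist_eq_norm]
    exact (hle hN0 ht).trans_lt hN
  obtain ⟨α, hα⟩ := cauchySeq_tendsto_of_complete hcauchy
  refine ⟨α, hα, fun s hs => le_of_tendsto (hα.const_sub (f (s • u))).norm ?_⟩
  filter_upwards [eventually_ge_atTop s] with t ht using hle hs ht

theorem tendsto_sub_of_norm_fderiv_le_exp_of_zero_notMem_segment (hc : 0 < c) (hC : 0 ≤ C)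
    (hf : Differentiable ℝ f) (hdf : ∀ x, ‖fderiv ℝ f x‖ ≤ C * Real.exp (-c * ‖x‖))
    {v w : E} (h0 : (0 : E) ∉ segment ℝ v w) :
    Tendsto (fun t : ℝ => f (t • w) - f (t • v)) atTop (nhds 0) := by
  have hcompact : IsCompact (segment ℝ v w) := by
    rw [segment_eq_image_lineMap]
    exact isCompact_Icc.image AffineMap.lineMap_continuous
  obtain ⟨z, hz, hmin⟩ := hcompact.exists_isMinOn ⟨v, left_mem_segment ℝ v w⟩
    continuous_norm.continuousOn
  have hz0 : 0 < ‖z‖ := norm_pos_iff.2 fun h => h0 (h ▸ hz)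
  have hb : 0 < c * ‖z‖ := mul_pos hc hz0
  have hlim : Tendsto (fun t : ℝ => C * ‖w - v‖ * (t * Real.exp (-(c * ‖z‖) * t))) atTop
      (nhds 0) := by
    simpa using (tendsto_rpow_mul_exp_neg_mul_atTop_nhds_zero 1 _ hb).const_mul (C * ‖w - v‖)
  refine squeeze_zero_norm' ?_ hlim
  filter_upwards [eventually_ge_atTop 0] with t ht
  have hD (x : E) (hx : x ∈ segment ℝ (t • v) (t • w)) :
      ‖fderiv ℝ f x‖ ≤ C * Real.exp (-(c * ‖z‖) * t) := by
    obtain ⟨a, b, ha, hb, hab, rfl⟩ := hx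
    have hy : ‖z‖ ≤ ‖a • v + b • w‖ := hmin ⟨a, b, ha, hb, hab, rfl⟩
    have hn : ‖a • t • v + b • t • w‖ = t * ‖a • v + b • w‖ := by
      rw [smul_comm a t, smul_comm b t, ← smul_add, norm_smul, Real.norm_of_nonneg ht]
    refine (hdf _).trans ?_
    rw [hn]
    refine mul_le_mul_of_nonneg_left (Real.exp_le_exp.2 ?_) hC
    nlinarith [mul_le_mul_of_nonneg_left hy (mul_nonneg hc.le ht)]
  refine ((convex_segment (t • v) (t • w)).norm_image_sub_le_of_norm_fderiv_le
    (fun x _ => hf x) hD (left_mem_segment ℝ _ _) (right_mem_segment ℝ _ _)).trans_eq ?_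
  rw [← smul_sub, norm_smul, Real.norm_of_nonneg ht]
  ring

theorem tendsto_sub_of_norm_fderiv_le_exp (hE : 1 < Module.rank ℝ E) (hc : 0 < c) (hC : 0 ≤ C)
    (hf : Differentiable ℝ f) (hdf : ∀ x, ‖fderiv ℝ f x‖ ≤ C * Real.exp (-c * ‖x‖))
    {u v : E} (hu : u ≠ 0) (hv : v ≠ 0) :
    Tendsto (fun t : ℝ => f (t • v) - f (t • u)) atTop (nhds 0) := by
  by_cases h0 : (0 : E) ∈ segment ℝ u v
  · obtain ⟨a, b, -, -, hab, h⟩ := h0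
    have hb : b ≠ 0 := by
      rintro rfl
      simp_all
    obtain ⟨w, hw⟩ := exists_linearIndependent_pair_of_one_lt_rank hE hu
    rw [LinearIndependent.pair_iff] at hw
    have huw : (0 : E) ∉ segment ℝ u w := by
      rintro ⟨p, q, -, -, hpq, h'⟩
      obtain ⟨rfl, rfl⟩ := hw p q h'
      simp at hpq
    have hwv : (0 : E) ∉ segment ℝ w v := by
      rintro ⟨p, q, -, -, hpq, h'⟩
      have hcomb : (-(q * a)) • u + (b * p) • w = 0 := by
        calc (-(q * a)) • u + (b * p) • w = b • (p • w + q • v) - q • (a • u + b • v) := by module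
          _ = 0 := by simp [h, h']
      obtain ⟨h1, h2⟩ := hw _ _ hcomb
      have hp : p = 0 := (mul_eq_zero.1 h2).resolve_left hb
      have hq : q = 1 := by linarith
      have ha : a = 0 := by simpa [hq] using h1
      simp_all
    simpa using
      (tendsto_sub_of_norm_fderiv_le_exp_of_zero_notMem_segment hc hC hf hdf hwv).add
        (tendsto_sub_of_norm_fderiv_le_exp_of_zero_notMem_segment hc hC hf hdf huw)
  · exact tendsto_sub_of_norm_fderiv_le_exp_of_zero_notMem_segment hc hC hf hdf h0

theorem exists_norm_sub_le_exp_of_norm_fderiv_le_exp [CompleteSpace F]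
    (hE : 1 < Module.rank ℝ E) (hc : 0 < c) (hC : 0 ≤ C)
    (hf : Differentiable ℝ f) (hdf : ∀ x, ‖fderiv ℝ f x‖ ≤ C * Real.exp (-c * ‖x‖)) :
    ∃ α : F, ∀ x, ‖f x - α‖ ≤ C / c * Real.exp (-c * ‖x‖) := by
  have : Nontrivial E := rank_pos_iff_nontrivial.1 (zero_lt_one.trans hE)
  obtain ⟨u, hu⟩ := exists_norm_eq E zero_le_one
  obtain ⟨α, hα, hαu⟩ := exists_tendsto_on_ray_of_norm_fderiv_le_exp hc hC hf hdf hu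
  refine ⟨α, fun x => ?_⟩
  rcases eq_or_ne x 0 with rfl | hx
  · simpa using hαu 0 le_rfl
  have hxn : ‖x‖ ≠ 0 := norm_ne_zero_iff.2 hx
  have hv : ‖‖x‖⁻¹ • x‖ = 1 := by simp [norm_smul, hxn]
  obtain ⟨β, hβ, hβx⟩ := exists_tendsto_on_ray_of_norm_fderiv_le_exp hc hC hf hdf hv
  have hβα : β = α := sub_eq_zero.1 <| tendsto_nhds_unique (hβ.sub hα) <|
    tendsto_sub_of_norm_fderiv_le_exp hE hc hC hf hdf
      (norm_ne_zero_iff.1 (hu ▸ one_ne_zero)) (norm_ne_zero_iff.1 (hv ▸ one_ne_zero))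
  simpa [smul_smul, hxn, hβα] using hβx ‖x‖ (norm_nonneg x)

end ExponentialDecay

/-- If `f : ℝⁿ → ℂ` (`n ≥ 2`) is differentiable with `‖Df(x)‖ ≤ C·exp(-c‖x‖)`, then
there are `α ∈ ℂ` and `C' ≥ 0` with `‖f(x) - α‖ ≤ C'·exp(-c‖x‖)` for all `x`; in
particular `f(x) → α` as `‖x‖ → ∞`. -/
theorem decay_of_function_with_exponentially_decaying_derivative
    (n : ℕ) (hn : 2 ≤ n) (c C : ℝ) (hc : 0 < c) (hC : 0 ≤ C)
    (f : EuclideanSpace ℝ (Fin n) → ℂ) (hf : Differentiable ℝ f)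
    (hdf : ∀ x, ‖fderiv ℝ f x‖ ≤ C * Real.exp (-c * ‖x‖)) :
    ∃ (α : ℂ) (C' : ℝ), 0 ≤ C' ∧
      (∀ x, ‖f x - α‖ ≤ C' * Real.exp (-c * ‖x‖)) ∧
      Tendsto f (cocompact (EuclideanSpace ℝ (Fin n))) (nhds α) := by
  have hE : 1 < Module.rank ℝ (EuclideanSpace ℝ (Fin n)) := by
    rw [← Module.finrank_eq_rank, finrank_euclideanSpace_fin]
    exact_mod_cast hn
  obtain ⟨α, hα⟩ := exists_norm_sub_le_exp_of_norm_fderiv_le_exp hE hc hC hf hdf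
  refine ⟨α, C / c, div_nonneg hC hc.le, hα, ?_⟩
  refine tendsto_iff_norm_sub_tendsto_zero.2 (squeeze_zero (fun _ => norm_nonneg _) hα ?_)
  simpa using (Real.tendsto_exp_atBot.comp ((tendsto_norm_cocompact_atTop
    (E := EuclideanSpace ℝ (Fin n))).const_mul_atTop_of_neg (neg_lt_zero.2 hc))).const_mul (C / c)
end

section
/- Let U ⊆ ℝ³ be open and let φ₁, φ₂, φ₃ : ℝ³ → ℝ be twice continuously differentiable on U, satisfying the system ∂φ₃/∂x₁ = φ₂ · ∂φ₁/∂x₁ and ∂φ₃/∂x₂ = φ₂ · ∂φ₁/∂x₂ at every point of U. Then at every point of U one has ∂φ₁/∂x₁ · ∂φ₂/∂x₂ = ∂φ₂/∂x₁ · ∂φ₁/∂x₂. -/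
/-- Differentiating a relation `∂ᵥ f = a · ∂ᵥ g`, valid near `x`, in a direction `w`. -/
lemma fderiv_fderiv_apply_of_eventuallyEq_mul {E : Type*} [NormedAddCommGroup E]
    [NormedSpace ℝ E] {f g a : E → ℝ} {x v : E} (hf : ContDiffAt ℝ 2 f x)
    (hg : ContDiffAt ℝ 2 g x) (ha : DifferentiableAt ℝ a x)
    (h : (fun y => fderiv ℝ f y v) =ᶠ[nhds x] fun y => a y * fderiv ℝ g y v) (w : E) :
    fderiv ℝ (fderiv ℝ f) x w v =
      a x * fderiv ℝ (fderiv ℝ g) x w v + fderiv ℝ g x v * fderiv ℝ a x w := by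
  have hf' : DifferentiableAt ℝ (fderiv ℝ f) x :=
    (hf.fderiv_right (m := 1) (by norm_num)).differentiableAt (by norm_num)
  have hg' : DifferentiableAt ℝ (fderiv ℝ g) x :=
    (hg.fderiv_right (m := 1) (by norm_num)).differentiableAt (by norm_num)
  have hfv := hf'.hasFDerivAt.clm_apply (hasFDerivAt_const v x)
  have hgv := hg'.hasFDerivAt.clm_apply (hasFDerivAt_const v x)
  have key := hfv.unique ((ha.hasFDerivAt.mul hgv).congr_of_eventuallyEq h)
  simpa using DFunLike.congr_fun key w

/-- If `φ₁, φ₂, φ₃` are C² on an open set `U ⊆ ℝ³` and satisfy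
`∂₁φ₃ = φ₂·∂₁φ₁` and `∂₂φ₃ = φ₂·∂₂φ₁` on `U`, then
`∂₁φ₁·∂₂φ₂ = ∂₁φ₂·∂₂φ₁` on `U`. -/
theorem crossed_derivative_identity (U : Set (Fin 3 → ℝ)) (hU : IsOpen U)
    (φ₁ φ₂ φ₃ : (Fin 3 → ℝ) → ℝ)
    (h1 : ContDiffOn ℝ 2 φ₁ U) (h2 : ContDiffOn ℝ 2 φ₂ U) (h3 : ContDiffOn ℝ 2 φ₃ U)
    (hsys1 : ∀ x ∈ U, fderiv ℝ φ₃ x (Pi.single 0 1) = φ₂ x * fderiv ℝ φ₁ x (Pi.single 0 1))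
    (hsys2 : ∀ x ∈ U, fderiv ℝ φ₃ x (Pi.single 1 1) = φ₂ x * fderiv ℝ φ₁ x (Pi.single 1 1)) :
    ∀ x ∈ U, fderiv ℝ φ₁ x (Pi.single 0 1) * fderiv ℝ φ₂ x (Pi.single 1 1) =
      fderiv ℝ φ₂ x (Pi.single 0 1) * fderiv ℝ φ₁ x (Pi.single 1 1) := by
  intro x hx
  have hxU : U ∈ nhds x := hU.mem_nhds hx
  have c1 := h1.contDiffAt hxU
  have c3 := h3.contDiffAt hxU
  have d2 := (h2.contDiffAt hxU).differentiableAt (by norm_num)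
  have e1 := fderiv_fderiv_apply_of_eventuallyEq_mul c3 c1 d2
    (Filter.eventually_of_mem hxU hsys1) (Pi.single 1 1)
  have e2 := fderiv_fderiv_apply_of_eventuallyEq_mul c3 c1 d2
    (Filter.eventually_of_mem hxU hsys2) (Pi.single 0 1)
  have s1 := c1.isSymmSndFDerivAt (by simp) (Pi.single 0 1) (Pi.single 1 1)
  have s3 := c3.isSymmSndFDerivAt (by simp) (Pi.single 0 1) (Pi.single 1 1)
  rw [s3, s1] at e2
  linarith
end

section
/- Let U ⊆ ℝ³ be open and let φ₁, φ₂, φ₃ : ℝ³ → ℝ be twice continuously differentiable on U, satisfying the system ∂φ₃/∂x₁ = φ₂ · ∂φ₁/∂x₁ and ∂φ₃/∂x₂ = φ₂ · ∂φ₁/∂x₂ at every point of U. Then the Jacobian determinant of the map φ = (φ₁, φ₂, φ₃) : ℝ³ → ℝ³, that is det(∂φ_i/∂x_j)_{1≤i,j≤3}, vanishes at every point of U. In particular, the derivative of φ is not invertible at any point of U, so φ is not a local diffeomorphism at any point of U. -/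
/-- If `dh` and `g • df` agree in the directions `u` and `v` near `x`, then
`dg ∧ df` vanishes on `(u, v)` at `x`. -/
theorem fderiv_mul_fderiv_comm_of_eventuallyEq {E : Type*} [NormedAddCommGroup E]
    [NormedSpace ℝ E] {f g h : E → ℝ} {x u v : E}
    (hf : ContDiffAt ℝ 2 f x) (hg : DifferentiableAt ℝ g x) (hh : ContDiffAt ℝ 2 h x)
    (hu : ∀ᶠ y in nhds x, fderiv ℝ h y u = g y * fderiv ℝ f y u)
    (hv : ∀ᶠ y in nhds x, fderiv ℝ h y v = g y * fderiv ℝ f y v) :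
    fderiv ℝ g x u * fderiv ℝ f x v = fderiv ℝ g x v * fderiv ℝ f x u := by
  have hdf : DifferentiableAt ℝ (fderiv ℝ f) x :=
    (hf.fderiv_right (m := 1) (by norm_num)).differentiableAt one_ne_zero
  have hdh : DifferentiableAt ℝ (fderiv ℝ h) x :=
    (hh.fderiv_right (m := 1) (by norm_num)).differentiableAt one_ne_zero
  have snd_fderiv {w : E} (z : E)
      (hw : ∀ᶠ y in nhds x, fderiv ℝ h y w = g y * fderiv ℝ f y w) :
      fderiv ℝ (fderiv ℝ h) x z w =
        g x * fderiv ℝ (fderiv ℝ f) x z w + fderiv ℝ f x w * fderiv ℝ g x z := by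
    have hL := hdh.hasFDerivAt.clm_apply (hasFDerivAt_const w x)
    have hR := hg.hasFDerivAt.mul (hdf.hasFDerivAt.clm_apply (hasFDerivAt_const w x))
    have := congrArg (fun T : E →L[ℝ] ℝ => T z) (hL.unique (hR.congr_of_eventuallyEq hw))
    simpa using this
  have symm_f := (hf.isSymmSndFDerivAt (by simp)) u v
  have symm_h := (hh.isSymmSndFDerivAt (by simp)) u v
  rw [snd_fderiv u hv, snd_fderiv v hu, symm_f] at symm_h
  linarith

/-- If `φ₁, φ₂, φ₃` are C² on an open set `U ⊆ ℝ³` and satisfy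
`∂₁φ₃ = φ₂·∂₁φ₁` and `∂₂φ₃ = φ₂·∂₂φ₁` on `U`, then the Jacobian determinant of
`φ = (φ₁,φ₂,φ₃)` vanishes on `U`; in particular the Jacobian matrix is not invertible
at any point of `U` and the derivative of `φ` is not a linear isomorphism at any
point of `U`, so `φ` is not a local diffeomorphism anywhere in `U`. -/
theorem jacobian_vanishes (U : Set (Fin 3 → ℝ)) (hU : IsOpen U)
    (φ₁ φ₂ φ₃ : (Fin 3 → ℝ) → ℝ)
    (h1 : ContDiffOn ℝ 2 φ₁ U) (h2 : ContDiffOn ℝ 2 φ₂ U) (h3 : ContDiffOn ℝ 2 φ₃ U)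
    (hsys1 : ∀ x ∈ U, fderiv ℝ φ₃ x (Pi.single 0 1) = φ₂ x * fderiv ℝ φ₁ x (Pi.single 0 1))
    (hsys2 : ∀ x ∈ U, fderiv ℝ φ₃ x (Pi.single 1 1) = φ₂ x * fderiv ℝ φ₁ x (Pi.single 1 1)) :
    ∀ x ∈ U,
      Matrix.det (Matrix.of fun i j : Fin 3 =>
          fderiv ℝ (![φ₁, φ₂, φ₃] i) x (Pi.single j 1)) = 0 ∧
      ¬ IsUnit (Matrix.of fun i j : Fin 3 =>
          fderiv ℝ (![φ₁, φ₂, φ₃] i) x (Pi.single j 1)) ∧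
      ¬ ∃ e : (Fin 3 → ℝ) ≃L[ℝ] (Fin 3 → ℝ),
          (e : (Fin 3 → ℝ) →L[ℝ] (Fin 3 → ℝ)) =
            fderiv ℝ (fun z => (fun i : Fin 3 => ![φ₁, φ₂, φ₃] i z)) x := by
  intro x hx
  have hUx := hU.mem_nhds hx
  have key := fderiv_mul_fderiv_comm_of_eventuallyEq (h1.contDiffAt hUx)
    ((h2.contDiffAt hUx).differentiableAt two_ne_zero) (h3.contDiffAt hUx)
    (Filter.eventually_of_mem hUx hsys1) (Filter.eventually_of_mem hUx hsys2)
  have hdet : Matrix.det (Matrix.of fun i j : Fin 3 =>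
      fderiv ℝ (![φ₁, φ₂, φ₃] i) x (Pi.single j 1)) = 0 := by
    simp only [Matrix.det_fin_three, Matrix.of_apply, Matrix.cons_val, hsys1 x hx, hsys2 x hx]
    linear_combination (φ₂ x * fderiv ℝ φ₁ x (Pi.single 2 1) -
      fderiv ℝ φ₃ x (Pi.single 2 1)) * key
  refine ⟨hdet, fun h => ?_, ?_⟩
  · rw [Matrix.isUnit_iff_isUnit_det, hdet] at h
    exact not_isUnit_zero h
  · rintro ⟨e, he⟩
    have hd : ∀ i, DifferentiableAt ℝ (![φ₁, φ₂, φ₃] i) x := by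
      intro i
      fin_cases i
      · exact (h1.contDiffAt hUx).differentiableAt two_ne_zero
      · exact (h2.contDiffAt hUx).differentiableAt two_ne_zero
      · exact (h3.contDiffAt hUx).differentiableAt two_ne_zero
    have hM : LinearMap.toMatrix' (e.toLinearEquiv : (Fin 3 → ℝ) →ₗ[ℝ] (Fin 3 → ℝ)) =
        Matrix.of fun i j : Fin 3 => fderiv ℝ (![φ₁, φ₂, φ₃] i) x (Pi.single j 1) := by
      ext i j
      have := congrArg (fun T : (Fin 3 → ℝ) →L[ℝ] (Fin 3 → ℝ) => T (Pi.single j 1) i) he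
      rw [fderiv_pi hd] at this
      simpa [LinearMap.toMatrix'_apply] using this
    have hu := e.toLinearEquiv.isUnit_det'
    rw [← LinearMap.det_toMatrix', hM, hdet] at hu
    exact not_isUnit_zero hu
end

section
/- Equip ℝ³ with the product (a,b,c) ∙ (a′,b′,c′) = (a+a′, b+b′, c+c′+a·b′), which makes ℝ³ a group with identity 0 and inverse (a,b,c)⁻¹ = (−a,−b, ab−c). Let m : ℝ³ → ℂ and φ = (φ₁,φ₂,φ₃) : ℝ³ → ℝ³ be differentiable, define M_φ(x,y) = m(φ(x) ∙ φ(y)⁻¹), and for w ∈ ℝ³ set 𝔻₁m(w) = (d/ds)|_{s=0} m(w ∙ (s,0,0)), 𝔻₂m(w) = (d/ds)|_{s=0} m(w ∙ (0,s,0)), 𝔻₃m(w) = (d/ds)|_{s=0} m(w ∙ (0,0,s)). Then for every j ∈ {1,2,3} and all x, y ∈ ℝ³, writing w = φ(x) ∙ φ(y)⁻¹: ∂M_φ/∂x_j(x,y) = ∂φ₁/∂x_j(x) · 𝔻₁m(w) + ∂φ₂/∂x_j(x) · 𝔻₂m(w) + [ ∂φ₃/∂x_j(x) + (φ₁(y)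 − φ₁(x)) · ∂φ₂/∂x_j(x) − φ₂(y) · ∂φ₁/∂x_j(x) ] · 𝔻₃m(w). -/
/-- The (matrix-coordinate) Heisenberg product on `ℝ³`:
`(a,b,c) ∙ (a',b',c') = (a+a', b+b', c+c'+a·b')`. -/
noncomputable def pmul (x y : ℝ × ℝ × ℝ) : ℝ × ℝ × ℝ :=
  (x.1 + y.1, x.2.1 + y.2.1, x.2.2 + y.2.2 + x.1 * y.2.1)

/-- Inverse for the product `pmul`: `(a,b,c)⁻¹ = (-a,-b,ab-c)`. -/
noncomputable def pinv (x : ℝ × ℝ × ℝ) : ℝ × ℝ × ℝ :=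
  (-x.1, -x.2.1, x.1 * x.2.1 - x.2.2)

/-- The standard basis vectors of `ℝ³` as `ℝ × ℝ × ℝ`. -/
noncomputable def e3 : Fin 3 → ℝ × ℝ × ℝ := ![(1, 0, 0), (0, 1, 0), (0, 0, 1)]

/-- The derivative of the left translate by `w` of a curve. -/
theorem HasDerivAt.pmul_left {γ : ℝ → ℝ × ℝ × ℝ} {v : ℝ × ℝ × ℝ} {t : ℝ}
    (hγ : HasDerivAt γ v t) (w : ℝ × ℝ × ℝ) :
    HasDerivAt (fun s => pmul w (γ s)) (v.1, v.2.1, v.2.2 + w.1 * v.2.1) t := by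
  have hfst : HasDerivAt (fun s => (γ s).1) v.1 t :=
    (ContinuousLinearMap.fst ℝ ℝ (ℝ × ℝ)).hasFDerivAt.comp_hasDerivAt t hγ
  have hsnd : HasDerivAt (fun s => (γ s).2) v.2 t :=
    (ContinuousLinearMap.snd ℝ ℝ (ℝ × ℝ)).hasFDerivAt.comp_hasDerivAt t hγ
  have hmid : HasDerivAt (fun s => (γ s).2.1) v.2.1 t :=
    (ContinuousLinearMap.fst ℝ ℝ ℝ).hasFDerivAt.comp_hasDerivAt t hsnd
  have hlast : HasDerivAt (fun s => (γ s).2.2) v.2.2 t :=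
    (ContinuousLinearMap.snd ℝ ℝ ℝ).hasFDerivAt.comp_hasDerivAt t hsnd
  exact (hfst.const_add w.1).prodMk ((hmid.const_add w.2.1).prodMk
    ((hlast.const_add w.2.2).add (hmid.const_mul w.1)))

theorem pmul_zero (w : ℝ × ℝ × ℝ) : pmul w 0 = w := by
  simp [pmul]

/-- The derivative of `m` along the left translate by `w` of a curve through the identity. -/
theorem deriv_comp_pmul_left {m : ℝ × ℝ × ℝ → ℂ} {w v : ℝ × ℝ × ℝ} {γ : ℝ → ℝ × ℝ × ℝ}
    (hm : DifferentiableAt ℝ m w) (hγ : HasDerivAt γ v 0) (h0 : γ 0 = 0) :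
    deriv (fun s => m (pmul w (γ s))) 0 =
      fderiv ℝ m w (v.1, v.2.1, v.2.2 + w.1 * v.2.1) := by
  have hw : pmul w (γ 0) = w := by rw [h0, pmul_zero]
  have hm' : HasFDerivAt m (fderiv ℝ m w) (pmul w (γ 0)) := by
    rw [hw]; exact hm.hasFDerivAt
  exact (hm'.comp_hasDerivAt (0 : ℝ) (hγ.pmul_left w)).deriv

/-- The derivative of `x ↦ m (φ(x) ∙ p)` in the direction `v`. -/
theorem fderiv_comp_pmul_right {E : Type*} [NormedAddCommGroup E] [NormedSpace ℝ E]
    {m : ℝ × ℝ × ℝ → ℂ} {φ₁ φ₂ φ₃ : E → ℝ} {x : E} {p : ℝ × ℝ × ℝ}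
    (hm : DifferentiableAt ℝ m (pmul (φ₁ x, φ₂ x, φ₃ x) p))
    (h1 : DifferentiableAt ℝ φ₁ x) (h2 : DifferentiableAt ℝ φ₂ x)
    (h3 : DifferentiableAt ℝ φ₃ x) (v : E) :
    fderiv ℝ (fun x' => m (pmul (φ₁ x', φ₂ x', φ₃ x') p)) x v =
      fderiv ℝ m (pmul (φ₁ x, φ₂ x, φ₃ x) p)
        (fderiv ℝ φ₁ x v, fderiv ℝ φ₂ x v, fderiv ℝ φ₃ x v + fderiv ℝ φ₁ x v * p.2.1) := by
  have h : HasFDerivAt (fun x' => pmul (φ₁ x', φ₂ x', φ₃ x') p)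
      ((fderiv ℝ φ₁ x).prod ((fderiv ℝ φ₂ x).prod
        (fderiv ℝ φ₃ x + p.2.1 • fderiv ℝ φ₁ x))) x :=
    (h1.hasFDerivAt.add_const p.1).prodMk ((h2.hasFDerivAt.add_const p.2.1).prodMk
      ((h3.hasFDerivAt.add_const p.2.2).add (h1.hasFDerivAt.mul_const p.2.1)))
  have hc := (HasFDerivAt.comp x hm.hasFDerivAt h).fderiv
  rw [Function.comp_def] at hc
  rw [hc]
  simp [mul_comm]

/-- Chain rule for `M_φ(x,y) = m(φ(x) ∙ φ(y)⁻¹)` on the Heisenberg group: for each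
`j ∈ {1,2,3}`, writing `w = φ(x) ∙ φ(y)⁻¹`,
`∂_{x_j} M_φ(x,y) = ∂_{x_j}φ₁(x)·𝔻₁m(w) + ∂_{x_j}φ₂(x)·𝔻₂m(w)
  + [∂_{x_j}φ₃(x) + (φ₁(y)-φ₁(x))·∂_{x_j}φ₂(x) - φ₂(y)·∂_{x_j}φ₁(x)]·𝔻₃m(w)`,
where `𝔻₁, 𝔻₂, 𝔻₃` are the left-invariant derivatives of `m`. -/
theorem heis_lift_partial_derivatives (m : ℝ × ℝ × ℝ → ℂ)
    (φ₁ φ₂ φ₃ : ℝ × ℝ × ℝ → ℝ)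
    (hm : Differentiable ℝ m)
    (h1 : Differentiable ℝ φ₁) (h2 : Differentiable ℝ φ₂) (h3 : Differentiable ℝ φ₃) :
    ∀ (j : Fin 3) (x y : ℝ × ℝ × ℝ),
      fderiv ℝ (fun x' => m (pmul (φ₁ x', φ₂ x', φ₃ x') (pinv (φ₁ y, φ₂ y, φ₃ y)))) x
          (e3 j) =
        ((fderiv ℝ φ₁ x (e3 j) : ℝ) : ℂ) *
          deriv (fun s : ℝ =>
            m (pmul (pmul (φ₁ x, φ₂ x, φ₃ x) (pinv (φ₁ y, φ₂ y, φ₃ y))) (s, 0, 0))) 0 +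
        ((fderiv ℝ φ₂ x (e3 j) : ℝ) : ℂ) *
          deriv (fun s : ℝ =>
            m (pmul (pmul (φ₁ x, φ₂ x, φ₃ x) (pinv (φ₁ y, φ₂ y, φ₃ y))) (0, s, 0))) 0 +
        ((fderiv ℝ φ₃ x (e3 j) + (φ₁ y - φ₁ x) * fderiv ℝ φ₂ x (e3 j)
            - φ₂ y * fderiv ℝ φ₁ x (e3 j) : ℝ) : ℂ) *
          deriv (fun s : ℝ =>
            m (pmul (pmul (φ₁ x, φ₂ x, φ₃ x) (pinv (φ₁ y, φ₂ y, φ₃ y))) (0, 0, s))) 0 := by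
  intro j x y
  have hid := hasDerivAt_id' (0 : ℝ)
  have hz := hasDerivAt_const (0 : ℝ) (0 : ℝ)
  rw [fderiv_comp_pmul_right (hm _) (h1 x) (h2 x) (h3 x),
    deriv_comp_pmul_left (hm _) (hid.prodMk (hz.prodMk hz)) rfl,
    deriv_comp_pmul_left (hm _) (hz.prodMk (hid.prodMk hz)) rfl,
    deriv_comp_pmul_left (hm _) (hz.prodMk (hz.prodMk hid)) rfl]
  simp only [← Complex.real_smul, ← map_smul, ← map_add]
  congr 1
  ext <;> simp [pmul, pinv]
  ring
end
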